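/- For all integers x, y, z ≥ 1 and a, b ≥ 1, one has ψ_{x+1,y-1,z-1}(a,b) · ψ_{x-1,y,z}(a,b) / ( ψ_{x,y-1,z-1}(a,b) · ψ_{x,y,z}(a,b) ) = x(x+a+b) / ( (x+y+z+a+b)(x+y+z+2a+2b) ). -/

import Mathlib

open Finset Nat

/-- Pochhammer symbol `(q)_n` for real `q` and integer `n`. -/
noncomputable def poch (q : ℝ) (n : ℤ) : ℝ :=
  if 0 ≤ n then ∏ i ∈ Finset.range n.toNat, (q + i)
  else 1 / ∏ i ∈ Finset.range (-n).toNat, (q - (i + 1))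

/-- Skipping Pochhammer symbol `[q]_n`. -/
noncomputable def spoch (q : ℝ) (n : ℤ) : ℝ :=
  if 0 ≤ n then ∏ i ∈ Finset.range n.toNat, (q + 2 * i)
  else 1 / ∏ i ∈ Finset.range (-n).toNat, (q - 2 * (i + 1))

/-- Trapezoidal product `T(q,n,m) = ∏_{i=0}^{m-1} (q+i)_{n-2i}`. -/
noncomputable def trapT (q : ℝ) (n m : ℤ) : ℝ :=
  ∏ i ∈ Finset.range m.toNat, poch (q + i) (n - 2 * i)

/-- Skipping trapezoidal product `V(q,n,m) = ∏_{i=0}^{m-1} [q+2i]_{n-2i}`. -/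
noncomputable def trapV (q : ℝ) (n m : ℤ) : ℝ :=
  ∏ i ∈ Finset.range m.toNat, spoch (q + 2 * i) (n - 2 * i)

/-- Hyperfactorial `H(n) = 0!·1!·2!⋯(n-1)!`. -/
def hyperfac (n : ℕ) : ℕ := ∏ i ∈ Finset.range n, i !

/-- Skipping hyperfactorial `H₂(n)`:
`0!·2!·4!⋯(n-2)!` if `n` is even, `1!·3!·5!⋯(n-2)!` if `n` is odd. -/
def hyperfac2 (n : ℕ) : ℕ :=
  ∏ i ∈ Finset.range (n / 2), (if n % 2 = 0 then (2 * i)! else (2 * i + 1)!)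

/-- Partial sum `s_k(t) = t 1 + ⋯ + t k` (sequences are indexed from 1). -/
def pSum (t : ℕ → ℕ) (k : ℕ) : ℕ := ∑ i ∈ Finset.Icc 1 k, t i

/-- `E(t) = t 2 + t 4 + ⋯ + t (2l)` for a sequence of length `2l`. -/
def evenSum (l : ℕ) (t : ℕ → ℕ) : ℕ := ∑ i ∈ Finset.Icc 1 l, t (2 * i)

/-- `Q(t₁,…,t_{2l})`. -/
noncomputable def Qfun (l : ℕ) (t : ℕ → ℕ) : ℝ :=
  ((∏ i ∈ Finset.Icc 1 l, ((pSum t (2 * i))! : ℝ) / ((pSum t (2 * i - 1))! : ℝ)) /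
      (hyperfac2 (2 * evenSum l t + 1) : ℝ)) *
    (∏ i ∈ Finset.Icc 1 l,
      ((hyperfac2 (2 * pSum t (2 * i) + 1) : ℝ) * (hyperfac (2 * pSum t (2 * i - 1) + 2) : ℝ)) /
        (hyperfac2 (2 * pSum t (2 * i - 1) + 3) : ℝ)) *
    (∏ p ∈ (Finset.Icc 1 (2 * l) ×ˢ Finset.Icc 1 (2 * l)).filter
        (fun p => p.1 < p.2 ∧ (p.2 - p.1) % 2 = 1),
      (hyperfac (pSum t p.2 - pSum t p.1) : ℝ) / (hyperfac (pSum t p.2 + pSum t p.1 + 1) : ℝ)) *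
    (∏ p ∈ (Finset.Icc 1 (2 * l) ×ˢ Finset.Icc 1 (2 * l)).filter
        (fun p => p.1 < p.2 ∧ (p.2 - p.1) % 2 = 0),
      (hyperfac (pSum t p.2 + pSum t p.1 + 1) : ℝ) / (hyperfac (pSum t p.2 - pSum t p.1) : ℝ))

/-- Build an indexed-from-1 sequence from a list. -/
def seqOf (L : List ℕ) : ℕ → ℕ := fun i => L.getD (i - 1) 0

/-- `Q` on four entries. -/
noncomputable def Q4 (t1 t2 t3 t4 : ℕ) : ℝ := Qfun 2 (seqOf [t1, t2, t3, t4])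

/-- Proctor's product formula `P_{a,b,c}`. -/
noncomputable def Pf (a b c : ℕ) : ℝ :=
  ∏ i ∈ Finset.Icc 1 a,
    ((∏ j ∈ Finset.Icc 1 (b - a + 1), ((c + i + j - 1 : ℕ) : ℝ) / ((i + j - 1 : ℕ) : ℝ)) *
      ∏ j ∈ Finset.Icc (b - a + 2) (b - a + i),
        ((2 * c + i + j - 1 : ℕ) : ℝ) / ((i + j - 1 : ℕ) : ℝ))

/-- Ciucu's product formula `P′_{a,b,c}`. -/
noncomputable def Pf' (a b c : ℕ) : ℝ :=
  (2 : ℝ) ^ (-(a : ℤ)) *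
    (∏ i ∈ Finset.Icc 1 a, ((2 * c + (b - a) + i : ℕ) : ℝ) / ((c + (b - a) + i : ℕ) : ℝ)) *
    Pf a b c

/-- `φ_{x,y,z}(a,b)`. -/
noncomputable def phi (x y z a b : ℕ) : ℝ :=
  (Pf y (y + 2 * a) b * Pf (z + b) (z + b) a * Q4 a b x (y + z) /
      Pf (y + z + b) (y + z + b) a) *
    (trapT ((x : ℝ) + b + 1) ((y : ℤ) + a - 1) a *
      trapT ((x : ℝ) + z + a + b + 2) ((y : ℤ) + a - 1) a *
      trapT (2 * (a : ℝ) + b + 2) ((y : ℤ) + b - 1) b *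
      trapT ((z : ℝ) + 1) ((y : ℤ) + b - 1) b) /
    (trapT ((b : ℝ) + 1) ((y : ℤ) + a - 1) a *
      trapT ((z : ℝ) + a + b + 2) ((y : ℤ) + a - 1) a *
      trapT ((x : ℝ) + 2 * a + b + 2) ((y : ℤ) + b - 1) b *
      trapT ((x : ℝ) + z + 1) ((y : ℤ) + b - 1) b)

/-- `ψ_{x,y,z}(a,b)`. -/
noncomputable def psi (x y z a b : ℕ) : ℝ :=
  (Pf' y (y + 2 * a + 1) b * Pf (z + b) (z + b) a * Q4 a b x (y + z) /
      Pf (y + z + b) (y + z + b) a) *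
    (trapV (2 * (a : ℝ) + 2 * b + 3) ((y : ℤ) + z - 1) y /
      trapV (2 * (x : ℝ) + 2 * a + 2 * b + 3) ((y : ℤ) + z - 1) y) *
    (trapT ((x : ℝ) + b + 1) ((y : ℤ) + z + 2 * a) y *
      trapT (2 * (a : ℝ) + b + 2) ((y : ℤ) + b - 1) b *
      trapT ((z : ℝ) + 1) ((y : ℤ) + b - 1) b) /
    (trapT ((b : ℝ) + 1) ((y : ℤ) + z + 2 * a) y *
      trapT ((x : ℝ) + 2 * a + b + 2) ((y : ℤ) + b - 1) b *
      trapT ((x : ℝ) + z + 1) ((y : ℤ) + b - 1) b)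


lemma poch_pos' (q : ℝ) (n : ℤ) (h1 : 0 < q) (h2 : 0 < q + n) : 0 < poch q n := by
  unfold poch
  split_ifs with h
  · exact Finset.prod_pos fun i _ => by positivity
  · refine one_div_pos.mpr (Finset.prod_pos fun i hi => ?_)
    have hi' : ((i : ℤ) + 1) ≤ -n := by
      have := Finset.mem_range.mp hi
      omega
    have : ((i : ℝ) + 1) ≤ -n := by exact_mod_cast hi'
    linarith

lemma spoch_pos' (q : ℝ) (n : ℤ) (h1 : 0 < q) (h2 : 0 < q + 2 * n) : 0 < spoch q n := by
  unfold spoch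
  split_ifs with h
  · exact Finset.prod_pos fun i _ => by positivity
  · refine one_div_pos.mpr (Finset.prod_pos fun i hi => ?_)
    have hi' : ((i : ℤ) + 1) ≤ -n := by
      have := Finset.mem_range.mp hi
      omega
    have : ((i : ℝ) + 1) ≤ -n := by exact_mod_cast hi'
    linarith

lemma poch_shift (q : ℝ) (n : ℤ) (h1 : 0 < q) (h2 : 0 < q + n) :
    poch (q + 1) n * q = poch q n * (q + n) := by
  have h3 := poch_pos' q n h1 h2
  have h4 := poch_pos' (q + 1) n (by linarith) (by linarith)
  unfold poch at *
  split_ifs at * with h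
  · obtain ⟨k, rfl⟩ := Int.eq_ofNat_of_zero_le h
    have e1 := Finset.prod_range_succ (fun i : ℕ => q + (i : ℝ)) k
    have e2 := Finset.prod_range_succ' (fun i : ℕ => q + (i : ℝ)) k
    simp only [Int.toNat_natCast, Int.cast_natCast]
    rw [← e1, e2]
    simp only [Nat.cast_zero, add_zero]
    congr 1
    refine Finset.prod_congr rfl fun i _ => ?_
    push_cast; ring
  · obtain ⟨k, hk⟩ := Int.eq_ofNat_of_zero_le (show 0 ≤ -n by omega)
    obtain rfl : n = -(k : ℤ) := by omega
    have e1 := Finset.prod_range_succ (fun i : ℕ => q - (i : ℝ)) k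
    have e2 := Finset.prod_range_succ' (fun i : ℕ => q - (i : ℝ)) k
    simp only [neg_neg, Int.toNat_natCast, Int.cast_natCast, Int.cast_neg] at *
    have e3 : ∏ i ∈ Finset.range k, (q + 1 - ((i : ℝ) + 1)) = ∏ i ∈ Finset.range k, (q - (i : ℝ)) :=
      Finset.prod_congr rfl fun i _ => by ring
    rw [e3] at h4 ⊢
    have h3' := (one_div_pos.mp h3).ne'
    have h4' := (one_div_pos.mp h4).ne'
    rw [e1] at e2
    push_cast at e2
    field_simp
    linarith

lemma spoch_shift (q : ℝ) (n : ℤ) (h1 : 0 < q) (h2 : 0 < q + 2 * n) :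
    spoch (q + 2) n * q = spoch q n * (q + 2 * n) := by
  have h3 := spoch_pos' q n h1 h2
  have h4 := spoch_pos' (q + 2) n (by linarith) (by linarith)
  unfold spoch at *
  split_ifs at * with h
  · obtain ⟨k, rfl⟩ := Int.eq_ofNat_of_zero_le h
    have e1 := Finset.prod_range_succ (fun i : ℕ => q + 2 * (i : ℝ)) k
    have e2 := Finset.prod_range_succ' (fun i : ℕ => q + 2 * (i : ℝ)) k
    simp only [Int.toNat_natCast, Int.cast_natCast]
    rw [← e1, e2]
    simp only [Nat.cast_zero, mul_zero, add_zero]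
    congr 1
    refine Finset.prod_congr rfl fun i _ => ?_
    push_cast; ring
  · obtain ⟨k, hk⟩ := Int.eq_ofNat_of_zero_le (show 0 ≤ -n by omega)
    obtain rfl : n = -(k : ℤ) := by omega
    have e1 := Finset.prod_range_succ (fun i : ℕ => q - 2 * (i : ℝ)) k
    have e2 := Finset.prod_range_succ' (fun i : ℕ => q - 2 * (i : ℝ)) k
    simp only [neg_neg, Int.toNat_natCast, Int.cast_natCast, Int.cast_neg] at *
    have e3 : ∏ i ∈ Finset.range k, (q + 2 - 2 * ((i : ℝ) + 1))
        = ∏ i ∈ Finset.range k, (q - 2 * (i : ℝ)) :=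
      Finset.prod_congr rfl fun i _ => by ring
    rw [e3] at h4 ⊢
    have h3' := (one_div_pos.mp h3).ne'
    have h4' := (one_div_pos.mp h4).ne'
    rw [e1] at e2
    push_cast at e2
    field_simp
    linarith

lemma rising_fact (k m : ℕ) :
    (∏ i ∈ Finset.range m, ((k : ℝ) + 1 + i)) * (k ! : ℝ) = ((k + m)! : ℝ) := by
  induction m with
  | zero => simp
  | succ m ih =>
    rw [Finset.prod_range_succ, ← add_assoc, Nat.factorial_succ]
    push_cast
    rw [← ih]; ring

lemma falling_fact (k m : ℕ) :
    (∏ i ∈ Finset.range m, ((k : ℝ) + m - i)) * (k ! : ℝ) = ((k + m)! : ℝ) := by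
  rw [← rising_fact, ← Finset.prod_range_reflect]
  congr 1
  refine Finset.prod_congr rfl fun i hi => ?_
  have := Finset.mem_range.mp hi
  rw [show m - 1 - i = m - (1 + i) by omega, Nat.cast_sub (by omega)]
  push_cast; ring

/-- Product of the first `n` odd numbers. -/
noncomputable def oddProd (n : ℕ) : ℝ := ∏ i ∈ Finset.range n, (2 * (i : ℝ) + 1)

lemma oddProd_pos (n : ℕ) : 0 < oddProd n := Finset.prod_pos fun i _ => by positivity

lemma oddProd_succ (n : ℕ) : oddProd (n + 1) = oddProd n * (2 * (n : ℝ) + 1) :=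
  Finset.prod_range_succ _ _

lemma rising_odd (k m : ℕ) :
    (∏ i ∈ Finset.range m, (2 * (k : ℝ) + 1 + 2 * i)) * oddProd k = oddProd (k + m) := by
  induction m with
  | zero => simp
  | succ m ih =>
    rw [Finset.prod_range_succ, ← add_assoc, oddProd_succ]
    push_cast
    rw [← ih]; ring

lemma falling_odd (k m : ℕ) :
    (∏ i ∈ Finset.range m, (2 * ((k : ℝ) + m) - 1 - 2 * i)) * oddProd k = oddProd (k + m) := by
  rw [← rising_odd, ← Finset.prod_range_reflect]
  congr 1
  refine Finset.prod_congr rfl fun i hi => ?_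
  have := Finset.mem_range.mp hi
  rw [show m - 1 - i = m - (1 + i) by omega, Nat.cast_sub (by omega)]
  push_cast; ring

lemma trapT_pos (q : ℝ) (n : ℤ) (k m r : ℕ) (hq : q = k + 1) (hn : n = (m : ℤ) + r - 1) :
    0 < trapT q n m := by
  subst hq hn
  unfold trapT
  refine Finset.prod_pos fun i hi => ?_
  have h : (i : ℝ) + 1 ≤ m := by
    have := Finset.mem_range.mp hi
    norm_cast at *
  have h0 : (0 : ℝ) ≤ k := by positivity
  have h0 : (0 : ℝ) ≤ r := by positivity
  refine poch_pos' _ _ (by positivity) ?_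
  push_cast; linarith

lemma trapV_pos (q : ℝ) (n : ℤ) (k m r : ℕ) (hq : q = 2 * k + 3) (hn : n = (m : ℤ) + r - 1) :
    0 < trapV q n m := by
  subst hq hn
  unfold trapV
  refine Finset.prod_pos fun i hi => ?_
  have h : (i : ℝ) + 1 ≤ m := by
    have := Finset.mem_range.mp hi
    norm_cast at *
  have h0 : (0 : ℝ) ≤ k := by positivity
  have h0 : (0 : ℝ) ≤ r := by positivity
  refine spoch_pos' _ _ (by positivity) ?_
  push_cast; linarith

lemma trapT_shift (q q' : ℝ) (n : ℤ) (k m r : ℕ) (hq : q = k + 1) (hq' : q' = q + 1)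
    (hn : n = (m : ℤ) + r - 1) :
    trapT q' n m = trapT q n m * (((k + r + m)! : ℝ) * (k ! : ℝ) /
      (((k + r)! : ℝ) * ((k + m)! : ℝ))) := by
  have key : trapT q' n m * ∏ i ∈ Finset.range m, ((k : ℝ) + 1 + i)
      = trapT q n m * ∏ i ∈ Finset.range m, (((k + r : ℕ) : ℝ) + m - i) := by
    subst hq' hq hn
    unfold trapT
    simp only [Int.toNat_natCast]
    rw [← Finset.prod_mul_distrib, ← Finset.prod_mul_distrib]
    refine Finset.prod_congr rfl fun i hi => ?_
    have h : (i : ℝ) + 1 ≤ m := by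
      have := Finset.mem_range.mp hi
      norm_cast at *
    have h0 : (0 : ℝ) ≤ k := by positivity
    have h0 : (0 : ℝ) ≤ r := by positivity
    have := poch_shift ((k : ℝ) + 1 + i) ((m : ℤ) + r - 1 - 2 * i) (by positivity)
      (by push_cast; linarith)
    rw [show (k : ℝ) + 1 + 1 + i = (k : ℝ) + 1 + i + 1 by ring, this]
    push_cast; ring
  have f1 := rising_fact k m
  have f2 := falling_fact (k + r) m
  rw [← f1, ← f2]
  have g1 : (k ! : ℝ) ≠ 0 := by positivity
  have g2 : ((k + r)! : ℝ) ≠ 0 := by positivity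
  have g3 : (∏ i ∈ Finset.range m, ((k : ℝ) + 1 + i)) ≠ 0 :=
    (Finset.prod_pos fun i _ => by positivity).ne'
  generalize (∏ i ∈ Finset.range m, ((k : ℝ) + 1 + i)) = A at *
  generalize (∏ i ∈ Finset.range m, (((k + r : ℕ) : ℝ) + m - i)) = B at *
  field_simp
  exact key

lemma trapV_shift (q q' : ℝ) (n : ℤ) (k m r : ℕ) (hq : q = 2 * k + 3) (hq' : q' = q + 2)
    (hn : n = (m : ℤ) + r - 1) :
    trapV q' n m = trapV q n m * (oddProd (k + 1 + r + m) * oddProd (k + 1) /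
      (oddProd (k + 1 + r) * oddProd (k + 1 + m))) := by
  have key : trapV q' n m * ∏ i ∈ Finset.range m, (2 * ((k + 1 : ℕ) : ℝ) + 1 + 2 * i)
      = trapV q n m * ∏ i ∈ Finset.range m, (2 * (((k + 1 + r : ℕ) : ℝ) + m) - 1 - 2 * i) := by
    subst hq' hq hn
    unfold trapV
    simp only [Int.toNat_natCast]
    rw [← Finset.prod_mul_distrib, ← Finset.prod_mul_distrib]
    refine Finset.prod_congr rfl fun i hi => ?_
    have h : (i : ℝ) + 1 ≤ m := by
      have := Finset.mem_range.mp hi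
      norm_cast at *
    have h0 : (0 : ℝ) ≤ k := by positivity
    have h0 : (0 : ℝ) ≤ r := by positivity
    have := spoch_shift (2 * (k : ℝ) + 3 + 2 * i) ((m : ℤ) + r - 1 - 2 * i) (by positivity)
      (by push_cast; linarith)
    rw [show 2 * (k : ℝ) + 3 + 2 + 2 * i = 2 * (k : ℝ) + 3 + 2 * i + 2 by ring,
      show 2 * ((k + 1 : ℕ) : ℝ) + 1 + 2 * i = 2 * (k : ℝ) + 3 + 2 * i by push_cast; ring, this]
    push_cast; ring
  have f1 := rising_odd (k + 1) m
  have f2 := falling_odd (k + 1 + r) m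
  rw [← f1, ← f2]
  have g1 := (oddProd_pos (k + 1)).ne'
  have g2 := (oddProd_pos (k + 1 + r)).ne'
  have g3 : (∏ i ∈ Finset.range m, (2 * ((k + 1 : ℕ) : ℝ) + 1 + 2 * i)) ≠ 0 :=
    (Finset.prod_pos fun i _ => by positivity).ne'
  generalize (∏ i ∈ Finset.range m, (2 * ((k + 1 : ℕ) : ℝ) + 1 + 2 * i)) = A at *
  generalize (∏ i ∈ Finset.range m, (2 * (((k + 1 + r : ℕ) : ℝ) + m) - 1 - 2 * i)) = B at *
  field_simp
  exact key

lemma Pf_pos (a b c : ℕ) : 0 < Pf a b c := by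
  unfold Pf
  refine Finset.prod_pos fun i hi => mul_pos ?_ ?_ <;>
  · refine Finset.prod_pos fun j hj => ?_
    have h1 := Finset.mem_Icc.mp hi
    have h2 := Finset.mem_Icc.mp hj
    refine div_pos ?_ ?_ <;> · rw [Nat.cast_pos]; omega

lemma Pf'_pos (a b c : ℕ) : 0 < Pf' a b c := by
  unfold Pf'
  refine mul_pos (mul_pos (by positivity) ?_) (Pf_pos _ _ _)
  refine Finset.prod_pos fun i hi => ?_
  have h1 := Finset.mem_Icc.mp hi
  refine div_pos ?_ ?_ <;> · rw [Nat.cast_pos]; omega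

lemma hyperfac_pos (n : ℕ) : (0 : ℝ) < hyperfac n := by
  rw [Nat.cast_pos]
  exact Finset.prod_pos fun i _ => Nat.factorial_pos _

lemma hyperfac2_pos (n : ℕ) : (0 : ℝ) < hyperfac2 n := by
  rw [Nat.cast_pos]
  refine Finset.prod_pos fun i _ => ?_
  split_ifs <;> exact Nat.factorial_pos _

lemma hyperfac_succ (n : ℕ) : (hyperfac (n + 1) : ℝ) = hyperfac n * (n ! : ℝ) := by
  unfold hyperfac
  rw [Finset.prod_range_succ]; push_cast; rfl

lemma hyperfac2_succ (n : ℕ) :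
    (hyperfac2 (2 * (n + 1) + 1) : ℝ) = hyperfac2 (2 * n + 1) * ((2 * n + 1)! : ℝ) := by
  unfold hyperfac2
  rw [show (2 * (n + 1) + 1) / 2 = n + 1 by omega, show (2 * n + 1) / 2 = n by omega,
    show (2 * (n + 1) + 1) % 2 = 1 by omega, show (2 * n + 1) % 2 = 1 by omega]
  simp only [one_ne_zero, if_false]
  rw [Finset.prod_range_succ]; push_cast; rfl

/-- The part of `Q4` depending on the third entry. -/
noncomputable def Qx (a b x w : ℕ) : ℝ :=
  (((a + b + x + w)! : ℝ) / ((a + b + x)! : ℝ)) *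
  ((hyperfac2 (2 * (a + b + x + w) + 1) : ℝ) * (hyperfac (2 * (a + b + x) + 2) : ℝ) /
    (hyperfac2 (2 * (a + b + x + 1) + 1) : ℝ)) *
  (((hyperfac (b + x + w) : ℝ) / (hyperfac (2 * a + b + x + w + 1) : ℝ)) *
   ((hyperfac x : ℝ) / (hyperfac (2 * a + 2 * b + x + 1) : ℝ)) *
   ((hyperfac w : ℝ) / (hyperfac (2 * (a + b + x) + w + 1) : ℝ))) *
  (((hyperfac (2 * a + b + x + 1) : ℝ) / (hyperfac (b + x) : ℝ)) *
   ((hyperfac (2 * a + 2 * b + x + w + 1) : ℝ) / (hyperfac (x + w) : ℝ)))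

/-- The part of `Q4` not depending on the third entry. -/
noncomputable def Qc (a b w : ℕ) : ℝ :=
  (((a + b)! : ℝ) / (a ! : ℝ)) / (hyperfac2 (2 * (b + w) + 1) : ℝ) *
  ((hyperfac2 (2 * (a + b) + 1) : ℝ) * (hyperfac (2 * a + 2) : ℝ) /
    (hyperfac2 (2 * a + 3) : ℝ)) *
  ((hyperfac b : ℝ) / (hyperfac (2 * a + b + 1) : ℝ))

lemma Q4_eq (a b x w : ℕ) : Q4 a b x w = Qc a b w * Qx a b x w := by
  have p1 : pSum (seqOf [a, b, x, w]) 1 = a := by simp [pSum, seqOf]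
  have p2 : pSum (seqOf [a, b, x, w]) 2 = a + b := by
    simp [pSum, seqOf, Finset.sum_Icc_succ_top]
  have p3 : pSum (seqOf [a, b, x, w]) 3 = a + b + x := by
    simp [pSum, seqOf, Finset.sum_Icc_succ_top]
  have p4 : pSum (seqOf [a, b, x, w]) 4 = a + b + x + w := by
    simp [pSum, seqOf, Finset.sum_Icc_succ_top]
  have e2 : evenSum 2 (seqOf [a, b, x, w]) = b + w := by
    simp [evenSum, seqOf, Finset.sum_Icc_succ_top]
  have F1 : (Finset.Icc 1 (2 * 2) ×ˢ Finset.Icc 1 (2 * 2)).filter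
        (fun p : ℕ × ℕ => p.1 < p.2 ∧ (p.2 - p.1) % 2 = 1)
        = {(1, 2), (1, 4), (2, 3), (3, 4)} := by decide
  have F2 : (Finset.Icc 1 (2 * 2) ×ˢ Finset.Icc 1 (2 * 2)).filter
        (fun p : ℕ × ℕ => p.1 < p.2 ∧ (p.2 - p.1) % 2 = 0)
        = {(1, 3), (2, 4)} := by decide
  have F3 : Finset.Icc 1 2 = ({1, 2} : Finset ℕ) := by decide
  unfold Q4 Qfun
  rw [F1, F2, F3, e2]
  rw [Finset.prod_pair (by decide), Finset.prod_pair (by decide), Finset.prod_pair (by decide),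
    Finset.prod_insert (by decide), Finset.prod_insert (by decide), Finset.prod_insert (by decide),
    Finset.prod_singleton]
  norm_num only [p1, p2, p3, p4]
  unfold Qc Qx
  rw [show a + b - a = b by omega, show a + b + x + w - a = b + x + w by omega,
    show a + b + x - (a + b) = x by omega, show a + b + x + w - (a + b + x) = w by omega,
    show a + b + x - a = b + x by omega, show a + b + x + w - (a + b) = x + w by omega,
    show a + b + a + 1 = 2 * a + b + 1 by omega,
    show a + b + x + w + a + 1 = 2 * a + b + x + w + 1 by omega,
    show a + b + x + (a + b) + 1 = 2 * a + 2 * b + x + 1 by omega,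
    show a + b + x + w + (a + b + x) + 1 = 2 * (a + b + x) + w + 1 by omega,
    show a + b + x + a + 1 = 2 * a + b + x + 1 by omega,
    show a + b + x + w + (a + b) + 1 = 2 * a + 2 * b + x + w + 1 by omega,
    show 2 * (a + b + x) + 3 = 2 * (a + b + x + 1) + 1 by omega]
  ring

lemma Q4_pos (a b x w : ℕ) : 0 < Q4 a b x w := by
  rw [Q4_eq]
  unfold Qc Qx
  have h1 := hyperfac_pos
  have h2 := hyperfac2_pos
  have h3 : ∀ n : ℕ, (0 : ℝ) < (n ! : ℝ) := fun n => by positivity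
  obtain ⟨Hf, hH⟩ : ∃ f : ℕ → ℝ, ∀ n, (hyperfac n : ℝ) = f n := ⟨_, fun _ => rfl⟩
  obtain ⟨Kf, hK⟩ : ∃ f : ℕ → ℝ, ∀ n, (hyperfac2 n : ℝ) = f n := ⟨_, fun _ => rfl⟩
  obtain ⟨Ff, hF⟩ : ∃ f : ℕ → ℝ, ∀ n, (n ! : ℝ) = f n := ⟨_, fun _ => rfl⟩
  simp only [hH, hK, hF] at *
  repeat' first
    | exact h1 _
    | exact h2 _
    | exact h3 _
    | apply _root_.div_pos
    | apply mul_pos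

/-- The ratio `Q(a,b,x+1,w)/Q(a,b,x,w)`. -/
noncomputable def Qr (a b x w : ℕ) : ℝ :=
  (((a + b + x + w : ℕ) : ℝ) + 1) / (((a + b + x : ℕ) : ℝ) + 1) *
  (((2 * (a + b + x + w) + 1)! : ℝ) * ((2 * (a + b + x) + 2)! : ℝ)) *
  (((b + x + w)! : ℝ) / ((2 * a + b + x + w + 1)! : ℝ) *
   ((x ! : ℝ) / ((2 * a + 2 * b + x + 1)! : ℝ)) *
   (1 / (((2 * (a + b + x) + w + 1)! : ℝ) * ((2 * (a + b + x) + w + 2)! : ℝ)))) *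
  (((2 * a + b + x + 1)! : ℝ) / ((b + x)! : ℝ) *
   (((2 * a + 2 * b + x + w + 1)! : ℝ) / ((x + w)! : ℝ)))

lemma Q4_alg (n1 n2 f1 f2 K1 g1 H1 g2 g3 K2 H3 g4 H4 g5 H5 g6 H6 g7 H7 H8 g8 g9 H9 g10 H10 g11
    H11 g12 H12 g13 : ℝ) (hn2 : n2 ≠ 0) (hf2 : f2 ≠ 0) (hK2 : K2 ≠ 0) (hg3 : g3 ≠ 0)
    (hH4 : H4 ≠ 0) (hg5 : g5 ≠ 0) (hH6 : H6 ≠ 0) (hg7 : g7 ≠ 0) (hH8 : H8 ≠ 0) (hg8 : g8 ≠ 0)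
    (hg9 : g9 ≠ 0) (hH10 : H10 ≠ 0) (hg11 : g11 ≠ 0) (hH12 : H12 ≠ 0) (hg13 : g13 ≠ 0) :
    n1 * f1 / (n2 * f2) * (K1 * g1 * (H1 * g2 * g3) / (K2 * g3)) *
      (H3 * g4 / (H4 * g5) * (H5 * g6 / (H6 * g7)) * (H7 / (H8 * g8 * g9))) *
      (H9 * g10 / (H10 * g11) * (H11 * g12 / (H12 * g13))) =
    f1 / f2 * (K1 * H1 / K2) * (H3 / H4 * (H5 / H6) * (H7 / H8)) * (H9 / H10 * (H11 / H12)) *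
      (n1 / n2 * (g1 * g2) * (g4 / g5 * (g6 / g7) * (1 / (g8 * g9))) *
        (g10 / g11 * (g12 / g13))) := by
  have h : K1 * g1 * (H1 * g2 * g3) / (K2 * g3) = K1 * H1 / K2 * (g1 * g2) := by
    field_simp
  rw [h]
  simp only [div_eq_mul_inv, mul_inv]
  ring

lemma Q4_shift (a b x w : ℕ) : Q4 a b (x + 1) w = Q4 a b x w * Qr a b x w := by
  rw [Q4_eq, Q4_eq, mul_assoc]
  congr 1
  unfold Qx Qr
  rw [show a + b + (x + 1) + w = a + b + x + w + 1 by omega,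
    show a + b + (x + 1) = a + b + x + 1 by omega,
    show 2 * (a + b + x + 1) + 2 = 2 * (a + b + x) + 2 + 1 + 1 by omega,
    show b + (x + 1) + w = b + x + w + 1 by omega,
    show 2 * a + b + (x + 1) + w + 1 = 2 * a + b + x + w + 1 + 1 by omega,
    show 2 * a + 2 * b + (x + 1) + 1 = 2 * a + 2 * b + x + 1 + 1 by omega,
    show 2 * (a + b + x + 1) + w + 1 = 2 * (a + b + x) + w + 1 + 1 + 1 by omega,
    show 2 * a + b + (x + 1) + 1 = 2 * a + b + x + 1 + 1 by omega,
    show b + (x + 1) = b + x + 1 by omega,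
    show 2 * a + 2 * b + (x + 1) + w + 1 = 2 * a + 2 * b + x + w + 1 + 1 by omega,
    show x + 1 + w = x + w + 1 by omega]
  rw [hyperfac2_succ (a + b + x + w), hyperfac2_succ (a + b + x + 1),
    hyperfac_succ (2 * (a + b + x) + 2 + 1), hyperfac_succ (2 * (a + b + x) + 2),
    hyperfac_succ (b + x + w), hyperfac_succ (2 * a + b + x + w + 1),
    hyperfac_succ x, hyperfac_succ (2 * a + 2 * b + x + 1),
    hyperfac_succ (2 * (a + b + x) + w + 1 + 1), hyperfac_succ (2 * (a + b + x) + w + 1),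
    hyperfac_succ (2 * a + b + x + 1), hyperfac_succ (b + x),
    hyperfac_succ (2 * a + 2 * b + x + w + 1), hyperfac_succ (x + w),
    Nat.factorial_succ (a + b + x + w), Nat.factorial_succ (a + b + x),
    show 2 * (a + b + x + 1) + 1 = 2 * (a + b + x) + 2 + 1 by omega]
  have h1 := fun n => (hyperfac_pos n).ne'
  have h2 := fun n => (hyperfac2_pos n).ne'
  have h3 : ∀ n : ℕ, (n ! : ℝ) ≠ 0 := fun n => by positivity
  have h4 : ∀ n : ℕ, (n : ℝ) + 1 ≠ 0 := fun n => by positivity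
  simp only [Nat.cast_mul, Nat.cast_succ]
  rw [show 2 * (a + b + x) + w + 1 + 1 = 2 * (a + b + x) + w + 2 by omega]
  exact Q4_alg _ _ _ _ _ _ _ _ _ _ _ _ _ _ _ _ _ _ _ _ _ _ _ _ _ _ _ _ _ _
    (h4 _) (h3 _) (h2 _) (h3 _) (h1 _) (h3 _) (h1 _) (h3 _) (h1 _) (h3 _) (h3 _) (h1 _) (h3 _)
    (h1 _) (h3 _)

/-- The ratio coming from a trapezoidal product. -/
noncomputable def Tr (k m r : ℕ) : ℝ :=
  ((k + r + m)! : ℝ) * (k ! : ℝ) / (((k + r)! : ℝ) * ((k + m)! : ℝ))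

/-- The ratio coming from a skipping trapezoidal product. -/
noncomputable def Vr (k m r : ℕ) : ℝ :=
  oddProd (k + 1 + r + m) * oddProd (k + 1) / (oddProd (k + 1 + r) * oddProd (k + 1 + m))

lemma Tr_pos (k m r : ℕ) : 0 < Tr k m r := by unfold Tr; positivity

lemma Vr_pos (k m r : ℕ) : 0 < Vr k m r :=
  div_pos (mul_pos (oddProd_pos _) (oddProd_pos _)) (mul_pos (oddProd_pos _) (oddProd_pos _))

/-- The ratio `ψ_{x+1,y,z}/ψ_{x,y,z}`. -/
noncomputable def psiR (x y z a b : ℕ) : ℝ :=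
  Qr a b x (y + z) / Vr (a + b + x) y z * Tr (x + b) y (z + 2 * a + 1) /
    (Tr (x + 2 * a + b + 1) b y * Tr (x + z) b y)

lemma psi_pos (x y z a b : ℕ) : 0 < psi x y z a b := by
  have v1 := trapV_pos (2 * (a : ℝ) + 2 * b + 3) ((y : ℤ) + z - 1) (a + b) y z
    (by push_cast; ring) rfl
  have v2 := trapV_pos (2 * (x : ℝ) + 2 * a + 2 * b + 3) ((y : ℤ) + z - 1) (a + b + x) y z
    (by push_cast; ring) rfl
  have t1 := trapT_pos ((x : ℝ) + b + 1) ((y : ℤ) + z + 2 * a) (x + b) y (z + 2 * a + 1)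
    (by push_cast; ring) (by push_cast; ring)
  have t2 := trapT_pos (2 * (a : ℝ) + b + 2) ((y : ℤ) + b - 1) (2 * a + b + 1) b y
    (by push_cast; ring) (by push_cast; ring)
  have t3 := trapT_pos ((z : ℝ) + 1) ((y : ℤ) + b - 1) z b y
    (by push_cast; ring) (by push_cast; ring)
  have t4 := trapT_pos ((b : ℝ) + 1) ((y : ℤ) + z + 2 * a) b y (z + 2 * a + 1)
    (by push_cast; ring) (by push_cast; ring)
  have t5 := trapT_pos ((x : ℝ) + 2 * a + b + 2) ((y : ℤ) + b - 1) (x + 2 * a + b + 1) b y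
    (by push_cast; ring) (by push_cast; ring)
  have t6 := trapT_pos ((x : ℝ) + z + 1) ((y : ℤ) + b - 1) (x + z) b y
    (by push_cast; ring) (by push_cast; ring)
  have q := Q4_pos a b x (y + z)
  have p1 := Pf_pos
  have p2 := Pf'_pos
  unfold psi
  repeat' first
    | assumption
    | exact p1 _ _ _
    | exact p2 _ _ _
    | apply _root_.div_pos
    | apply mul_pos

lemma psi_shift (x y z a b : ℕ) : psi (x + 1) y z a b = psi x y z a b * psiR x y z a b := by
  have v2 := trapV_shift (2 * (x : ℝ) + 2 * a + 2 * b + 3)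
    (2 * ((x + 1 : ℕ) : ℝ) + 2 * a + 2 * b + 3) ((y : ℤ) + z - 1) (a + b + x) y z
    (by push_cast; ring) (by push_cast; ring) rfl
  have t1 := trapT_shift ((x : ℝ) + b + 1) (((x + 1 : ℕ) : ℝ) + b + 1) ((y : ℤ) + z + 2 * a)
    (x + b) y (z + 2 * a + 1)
    (by push_cast; ring) (by push_cast; ring) (by push_cast; ring)
  have t5 := trapT_shift ((x : ℝ) + 2 * a + b + 2) (((x + 1 : ℕ) : ℝ) + 2 * a + b + 2)
    ((y : ℤ) + b - 1) (x + 2 * a + b + 1) b y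
    (by push_cast; ring) (by push_cast; ring) (by push_cast; ring)
  have t6 := trapT_shift ((x : ℝ) + z + 1) (((x + 1 : ℕ) : ℝ) + z + 1) ((y : ℤ) + b - 1)
    (x + z) b y
    (by push_cast; ring) (by push_cast; ring) (by push_cast; ring)
  unfold psi psiR
  rw [v2, t1, t5, t6, Q4_shift]
  rw [Tr, Tr, Tr, Vr]
  generalize ((x + b + (z + 2 * a + 1) + y)! : ℝ) * ((x + b)! : ℝ) /
    (((x + b + (z + 2 * a + 1))! : ℝ) * ((x + b + y)! : ℝ)) = A1
  generalize ((x + 2 * a + b + 1 + y + b)! : ℝ) * ((x + 2 * a + b + 1)! : ℝ) /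
    (((x + 2 * a + b + 1 + y)! : ℝ) * ((x + 2 * a + b + 1 + b)! : ℝ)) = A2
  generalize ((x + z + y + b)! : ℝ) * ((x + z)! : ℝ) /
    (((x + z + y)! : ℝ) * ((x + z + b)! : ℝ)) = A3
  generalize oddProd _ * oddProd _ / (oddProd _ * oddProd _) = A4
  ring

lemma Tr_rel1 (k m r : ℕ) :
    Tr (k + 1) m r = Tr k (m + 1) (r + 1) * (((k : ℝ) + 1) / ((k : ℝ) + r + m + 2)) := by
  unfold Tr
  rw [show k + (r + 1) + (m + 1) = k + r + m + 1 + 1 by omega,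
    show k + 1 + r + m = k + r + m + 1 by omega,
    show k + 1 + r = k + r + 1 by omega, show k + (r + 1) = k + r + 1 by omega,
    show k + 1 + m = k + m + 1 by omega, show k + (m + 1) = k + m + 1 by omega,
    Nat.factorial_succ (k + r + m + 1), Nat.factorial_succ k]
  have h : ∀ n : ℕ, (n ! : ℝ) ≠ 0 := fun n => by positivity
  simp only [Nat.cast_mul, Nat.cast_add, Nat.cast_one]
  have h1 := h (k + r + 1)
  have h2 := h (k + m + 1)
  generalize ((k + r + m + 1)! : ℝ) = A at *
  generalize ((k + r + 1)! : ℝ) = B at *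
  generalize ((k + m + 1)! : ℝ) = C at *
  generalize (k ! : ℝ) = D at *
  have h3 : (k : ℝ) + r + m + 2 ≠ 0 := by positivity
  field_simp
  ring

lemma Tr_rel2 (k m r : ℕ) :
    Tr (k + 1) m r = Tr k m (r + 1) * (((k : ℝ) + 1) / ((k : ℝ) + m + 1)) := by
  unfold Tr
  rw [show k + (r + 1) + m = k + r + m + 1 by omega,
    show k + 1 + r + m = k + r + m + 1 by omega,
    show k + 1 + r = k + r + 1 by omega, show k + (r + 1) = k + r + 1 by omega,
    show k + 1 + m = k + m + 1 by omega,
    Nat.factorial_succ (k + m), Nat.factorial_succ k]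
  have h : ∀ n : ℕ, (n ! : ℝ) ≠ 0 := fun n => by positivity
  simp only [Nat.cast_mul, Nat.cast_add, Nat.cast_one]
  have h1 := h (k + r + 1)
  have h2 := h (k + m)
  generalize ((k + r + m + 1)! : ℝ) = A at *
  generalize ((k + r + 1)! : ℝ) = B at *
  generalize ((k + m)! : ℝ) = C at *
  generalize (k ! : ℝ) = D at *
  have h3 : (k : ℝ) + m + 1 ≠ 0 := by positivity
  field_simp

lemma Tr_rel3 (k m r : ℕ) :
    Tr k m r = Tr k m (r + 1) * (((k : ℝ) + r + 1) / ((k : ℝ) + r + m + 1)) := by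
  unfold Tr
  rw [show k + (r + 1) + m = k + r + m + 1 by omega, show k + (r + 1) = k + r + 1 by omega,
    Nat.factorial_succ (k + r + m), Nat.factorial_succ (k + r)]
  have h : ∀ n : ℕ, (n ! : ℝ) ≠ 0 := fun n => by positivity
  simp only [Nat.cast_mul, Nat.cast_add, Nat.cast_one]
  have h1 := h (k + r)
  have h2 := h (k + m)
  generalize ((k + r + m)! : ℝ) = A at *
  generalize ((k + r)! : ℝ) = B at *
  generalize ((k + m)! : ℝ) = C at *
  generalize (k ! : ℝ) = D at *
  have h3 : (k : ℝ) + r + m + 1 ≠ 0 := by positivity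
  have h4 : (k : ℝ) + r + 1 ≠ 0 := by positivity
  field_simp

lemma Vr_rel (k m r : ℕ) :
    Vr (k + 1) m r = Vr k (m + 1) (r + 1) *
      ((2 * (k : ℝ) + 3) / (2 * (k : ℝ) + 2 * r + 2 * m + 5)) := by
  unfold Vr
  rw [show k + 1 + (r + 1) + (m + 1) = k + r + m + 2 + 1 by omega,
    show k + 1 + 1 + r + m = k + r + m + 2 by omega,
    show k + 1 + 1 + r = k + r + 2 by omega, show k + 1 + (r + 1) = k + r + 2 by omega,
    show k + 1 + 1 + m = k + m + 2 by omega, show k + 1 + (m + 1) = k + m + 2 by omega,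
    oddProd_succ (k + r + m + 2), oddProd_succ (k + 1)]
  have h1 := (oddProd_pos (k + r + 2)).ne'
  have h2 := (oddProd_pos (k + m + 2)).ne'
  have h3 : 2 * (k : ℝ) + 2 * r + 2 * m + 5 ≠ 0 := by positivity
  push_cast
  field_simp
  ring

lemma Qr_rel (a b x w : ℕ) :
    Qr a b (x + 1) w = Qr a b x (w + 2) *
      ((((a + b + x : ℕ) : ℝ) + 1) * (2 * ((a + b + x : ℕ) : ℝ) + 3) *
        (2 * a + b + x + w + 3) * (x + 1) * (2 * a + b + x + 2) * (x + w + 2) /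
      ((((a + b + x : ℕ) : ℝ) + w + 3) * (2 * ((a + b + x : ℕ) : ℝ) + 2 * w + 5) *
        (b + x + w + 2) * (2 * a + 2 * b + x + 2) * (b + x + 1) *
        (2 * a + 2 * b + x + w + 3))) := by
  unfold Qr
  obtain ⟨s, hs⟩ : ∃ s, s = a + b + x := ⟨_, rfl⟩
  rw [show a + b + (x + 1) = a + b + x + 1 by omega, ← hs,
    show 2 * (s + 1 + w) + 1 = 2 * s + 2 * w + 3 by omega,
    show 2 * (s + 1) + 2 = 2 * s + 2 + 1 + 1 by omega,
    show b + (x + 1) + w = b + x + w + 1 by omega,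
    show 2 * a + b + (x + 1) + w + 1 = 2 * a + b + x + w + 2 by omega,
    show 2 * a + 2 * b + (x + 1) + 1 = 2 * a + 2 * b + x + 1 + 1 by omega,
    show 2 * (s + 1) + w + 1 = 2 * s + w + 3 by omega,
    show 2 * (s + 1) + w + 2 = 2 * s + w + 4 by omega,
    show 2 * a + b + (x + 1) + 1 = 2 * a + b + x + 1 + 1 by omega,
    show b + (x + 1) = b + x + 1 by omega,
    show 2 * a + 2 * b + (x + 1) + w + 1 = 2 * a + 2 * b + x + w + 2 by omega,
    show x + 1 + w = x + w + 1 by omega,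
    show 2 * (s + (w + 2)) + 1 = 2 * s + 2 * w + 3 + 1 + 1 by omega,
    show b + x + (w + 2) = b + x + w + 1 + 1 by omega,
    show 2 * a + b + x + (w + 2) + 1 = 2 * a + b + x + w + 2 + 1 by omega,
    show 2 * s + (w + 2) + 1 = 2 * s + w + 3 by omega,
    show 2 * s + (w + 2) + 2 = 2 * s + w + 4 by omega,
    show 2 * a + 2 * b + x + (w + 2) + 1 = 2 * a + 2 * b + x + w + 2 + 1 by omega,
    show x + (w + 2) = x + w + 1 + 1 by omega]
  have h3 : ∀ n : ℕ, (n ! : ℝ) ≠ 0 := fun n => by positivity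
  have h5 : ∀ n : ℕ, ((n + 1)! : ℝ) = ((n : ℝ) + 1) * (n ! : ℝ) := fun n => by
    rw [Nat.factorial_succ]; push_cast; rfl
  rw [h5 (2 * s + 2 + 1), h5 (2 * s + 2), h5 (2 * a + 2 * b + x + 1), h5 (2 * a + b + x + 1),
    h5 x, h5 (b + x), h5 (2 * s + 2 * w + 3 + 1), h5 (2 * s + 2 * w + 3), h5 (b + x + w + 1),
    h5 (2 * a + b + x + w + 2), h5 (2 * a + 2 * b + x + w + 2), h5 (x + w + 1)]
  clear h5
  have d1 := h3 (2 * a + b + x + w + 2)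
  have d2 := h3 (2 * a + 2 * b + x + 1)
  have d3 := h3 (2 * s + w + 3)
  have d4 := h3 (2 * s + w + 4)
  have d5 := h3 (b + x)
  have d6 := h3 (x + w + 1)
  obtain ⟨Ff, hF⟩ : ∃ f : ℕ → ℝ, ∀ n, (n ! : ℝ) = f n := ⟨_, fun _ => rfl⟩
  simp only [hF] at *
  clear hF h3
  generalize Ff (2 * a + b + x + w + 2) = A1 at *
  generalize Ff (2 * a + 2 * b + x + 1) = A2 at *
  generalize Ff (2 * s + w + 3) = A3 at *
  generalize Ff (2 * s + w + 4) = A4 at *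
  generalize Ff (b + x) = A5 at *
  generalize Ff (x + w + 1) = A6 at *
  generalize Ff (2 * s + 2 * w + 3) = A7
  generalize Ff (2 * s + 2) = A8
  generalize Ff (b + x + w + 1) = A9
  generalize Ff (2 * a + b + x + 1) = A10
  generalize Ff (2 * a + 2 * b + x + w + 2) = A11
  generalize Ff x = A12
  clear hs Ff
  push_cast
  field_simp
  ring

lemma psiR_alg (A1 A2 A3 A4 A5 p q e f g h i j k l m n : ℝ) (hq : q ≠ 0) (he : e ≠ 0)
    (hg : g ≠ 0) (hh : h ≠ 0) (hi : i ≠ 0) (hj : j ≠ 0) (hk : k ≠ 0) (hl : l ≠ 0) (hm : m ≠ 0)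
    (hn : n ≠ 0) :
    A5 * (p * q * e * f * g * h / (i * j * k * l * m * n)) / (A1 * (q / j)) * (A4 * (m / e)) /
      (A2 * (g / l) * (A3 * (h / k))) * (i * n) =
    A5 / A1 * A4 / (A2 * A3) * (f * p) := by
  simp only [div_eq_mul_inv, mul_inv, inv_inv]
  have c (t : ℝ) (ht : t ≠ 0) : t * t⁻¹ = 1 := mul_inv_cancel₀ ht
  calc _ = A5 * A1⁻¹ * A4 * (A2⁻¹ * A3⁻¹) * (f * p) * (q * q⁻¹) * (e * e⁻¹) * (g * g⁻¹) *
        (h * h⁻¹) * (i * i⁻¹) * (j * j⁻¹) * (k * k⁻¹) * (l * l⁻¹) * (m * m⁻¹) * (n * n⁻¹) := by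
        generalize q⁻¹ = qi, e⁻¹ = ei, g⁻¹ = gi, h⁻¹ = hi, i⁻¹ = ii, j⁻¹ = ji, k⁻¹ = ki,
          l⁻¹ = li, m⁻¹ = mi, n⁻¹ = ni
        ring
    _ = _ := by
        rw [c q hq, c e he, c g hg, c h hh, c i hi, c j hj, c k hk, c l hl, c m hm, c n hn]
        ring

lemma psiR_ratio (x y z a b : ℕ) :
    psiR (x + 1) y z a b * ((((x + 1 : ℕ) : ℝ) + ((y + 1 : ℕ) : ℝ) + ((z + 1 : ℕ) : ℝ) + a + b) *
      (((x + 1 : ℕ) : ℝ) + ((y + 1 : ℕ) : ℝ) + ((z + 1 : ℕ) : ℝ) + 2 * a + 2 * b)) =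
    psiR x (y + 1) (z + 1) a b *
      (((x + 1 : ℕ) : ℝ) * (((x + 1 : ℕ) : ℝ) + a + b)) := by
  unfold psiR
  rw [show y + 1 + (z + 1) = y + z + 2 by omega, show a + b + (x + 1) = a + b + x + 1 by omega,
    show x + 1 + b = x + b + 1 by omega,
    show x + 1 + 2 * a + b + 1 = x + 2 * a + b + 1 + 1 by omega,
    show x + 1 + z = x + (z + 1) by omega,
    show z + 1 + 2 * a + 1 = z + 2 * a + 1 + 1 by omega]
  rw [Qr_rel, Vr_rel, Tr_rel1 (x + b) y, Tr_rel2 (x + 2 * a + b + 1) b y,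
    Tr_rel3 (x + (z + 1)) b y]
  generalize Vr (a + b + x) (y + 1) (z + 1) = A1
  generalize Tr (x + 2 * a + b + 1) b (y + 1) = A2
  generalize Tr (x + (z + 1)) b (y + 1) = A3
  generalize Tr (x + b) (y + 1) _ = A4
  generalize Qr a b x _ = A5
  have key := psiR_alg A1 A2 A3 A4 A5 (((a + b + x : ℕ) : ℝ) + 1)
    (2 * ((a + b + x : ℕ) : ℝ) + 3) (2 * a + b + x + (y + z : ℕ) + 3) (x + 1)
    (2 * a + b + x + 2) (x + (y + z : ℕ) + 2)
    (((a + b + x : ℕ) : ℝ) + (y + z : ℕ) + 3)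
    (2 * ((a + b + x : ℕ) : ℝ) + 2 * (y + z : ℕ) + 5) (b + x + (y + z : ℕ) + 2)
    (2 * a + 2 * b + x + 2) (b + x + 1) (2 * a + 2 * b + x + (y + z : ℕ) + 3)
    (by positivity) (by positivity) (by positivity) (by positivity) (by positivity)
    (by positivity) (by positivity) (by positivity) (by positivity) (by positivity)
  have u1 : 2 * ((a + b + x : ℕ) : ℝ) + 2 * z + 2 * y + 5
      = 2 * ((a + b + x : ℕ) : ℝ) + 2 * (y + z : ℕ) + 5 := by push_cast; ring
  have u2 : ((x + b : ℕ) : ℝ) + 1 = b + x + 1 := by push_cast; ring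
  have u3 : ((x + b : ℕ) : ℝ) + (z + 2 * a + 1 : ℕ) + y + 2
      = 2 * a + b + x + (y + z : ℕ) + 3 := by push_cast; ring
  have u4 : ((x + 2 * a + b + 1 : ℕ) : ℝ) + 1 = 2 * a + b + x + 2 := by push_cast; ring
  have u5 : ((x + 2 * a + b + 1 : ℕ) : ℝ) + b + 1 = 2 * a + 2 * b + x + 2 := by push_cast; ring
  have u6 : ((x + (z + 1) : ℕ) : ℝ) + y + 1 = x + (y + z : ℕ) + 2 := by push_cast; ring
  have u7 : ((x + (z + 1) : ℕ) : ℝ) + y + b + 1 = b + x + (y + z : ℕ) + 2 := by push_cast; ring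
  have u8 : ((x + 1 : ℕ) : ℝ) + ((y + 1 : ℕ) : ℝ) + ((z + 1 : ℕ) : ℝ) + a + b
      = ((a + b + x : ℕ) : ℝ) + (y + z : ℕ) + 3 := by push_cast; ring
  have u9 : ((x + 1 : ℕ) : ℝ) + ((y + 1 : ℕ) : ℝ) + ((z + 1 : ℕ) : ℝ) + 2 * a + 2 * b
      = 2 * a + 2 * b + x + (y + z : ℕ) + 3 := by push_cast; ring
  have u10 : ((x + 1 : ℕ) : ℝ) + a + b = ((a + b + x : ℕ) : ℝ) + 1 := by push_cast; ring
  have u11 : ((x + 1 : ℕ) : ℝ) = x + 1 := by push_cast; ring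
  rw [u1, u2, u3, u4, u5, u6, u7, u8, u9, u10, u11]
  exact key

/-- second ratio of `ψ`'s in the Kuo recurrence. -/
theorem claim_psi_ratio_two (x y z a b : ℕ) (hx : 1 ≤ x) (hy : 1 ≤ y) (hz : 1 ≤ z)
    (ha : 1 ≤ a) (hb : 1 ≤ b) :
    psi (x + 1) (y - 1) (z - 1) a b * psi (x - 1) y z a b /
        (psi x (y - 1) (z - 1) a b * psi x y z a b) =
      (x : ℝ) * ((x : ℝ) + a + b) /
        (((x : ℝ) + y + z + a + b) * ((x : ℝ) + y + z + 2 * a + 2 * b)) := by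
  obtain ⟨x, rfl⟩ := Nat.exists_eq_add_of_le' hx
  obtain ⟨y, rfl⟩ := Nat.exists_eq_add_of_le' hy
  obtain ⟨z, rfl⟩ := Nat.exists_eq_add_of_le' hz
  simp only [Nat.add_sub_cancel]
  rw [psi_shift (x + 1) y z a b, psi_shift x (y + 1) (z + 1) a b]
  have h := psiR_ratio x y z a b
  have h1 := (psi_pos (x + 1) y z a b).ne'
  have h2 := (psi_pos x (y + 1) (z + 1) a b).ne'
  have h3 : psiR x (y + 1) (z + 1) a b ≠ 0 := by
    intro h0
    have := (psi_pos (x + 1) (y + 1) (z + 1) a b).ne'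
    rw [psi_shift, h0, mul_zero] at this
    exact this rfl
  rw [div_eq_div_iff (mul_ne_zero h1 (mul_ne_zero h2 h3)) (by positivity)]
  linear_combination (psi (x + 1) y z a b * psi x (y + 1) (z + 1) a b) * h
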